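/- Under assumptions (A1°) and (A2°), for each pair of class labels 1 ≤ j, i ≤ J and for independent random vectors X ~ F_j^{(d)} and Y ~ F_i^{(d)}, the sequence ‖X − Y‖₁/d − E(‖X − Y‖₁/d) converges in probability to 0 as d → ∞. -/

import Mathlib

open MeasureTheory ProbabilityTheory Filter

/-- The covariance of two real-valued functions under a measure. -/
noncomputable def pCov {α : Type*} [MeasurableSpace α] (μ : Measure α) (f g : α → ℝ) : ℝ :=
  (∫ x, f x * g x ∂μ) - (∫ x, f x ∂μ) * (∫ x, g x ∂μ)

/-- The correlation of two real-valued functions under a measure. -/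
noncomputable def pCorr {α : Type*} [MeasurableSpace α] (μ : Measure α) (f g : α → ℝ) : ℝ :=
  pCov μ f g / (Real.sqrt (pCov μ f f) * Real.sqrt (pCov μ g g))

theorem pCov_eq_cov_aux {α : Type*} [MeasurableSpace α] (μ : Measure α) [IsProbabilityMeasure μ]
    {f g : α → ℝ} (hf : MemLp f 2 μ) (hg : MemLp g 2 μ) : pCov μ f g = cov[f, g; μ] := by
  rw [covariance_eq_sub hf hg]
  rfl

theorem cov_zero_aux {α : Type*} [MeasurableSpace α] (μ : Measure α) [IsProbabilityMeasure μ]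
    {f g : α → ℝ} (hf : MemLp f 2 μ) (h : Var[f; μ] = 0) : cov[f, g; μ] = 0 := by
  have := ae_eq_integral_of_variance_eq_zero hf h
  refine integral_eq_zero_of_ae ?_
  filter_upwards [this] with x hx
  simp [← hx]

theorem cov_le_aux {α : Type*} [MeasurableSpace α] (μ : Measure α) [IsProbabilityMeasure μ]
    {f g : α → ℝ} {K : ℝ} (hf : MemLp f 2 μ) (hg : MemLp g 2 μ)
    (hfK : Var[f; μ] ≤ K) (hgK : Var[g; μ] ≤ K) :
    cov[f, g; μ] ≤ K * |pCorr μ f g| := by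
  have hK : 0 ≤ K := (variance_nonneg f μ).trans hfK
  rcases (variance_nonneg f μ).eq_or_lt with h | h
  · rw [cov_zero_aux μ hf h.symm]; positivity
  rcases (variance_nonneg g μ).eq_or_lt with h' | h'
  · rw [covariance_comm, cov_zero_aux μ hg h'.symm]; positivity
  unfold pCorr
  rw [pCov_eq_cov_aux μ hf hg, pCov_eq_cov_aux μ hf hf, pCov_eq_cov_aux μ hg hg,
    covariance_self hf.aemeasurable, covariance_self hg.aemeasurable, abs_div]
  have h1 := Real.sqrt_pos.2 h
  have h2 := Real.sqrt_pos.2 h'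
  rw [abs_of_pos (mul_pos h1 h2), mul_div_assoc', le_div_iff₀ (mul_pos h1 h2)]
  have h3 : Real.sqrt (Var[f; μ]) * Real.sqrt (Var[g; μ]) ≤ K := by
    calc _ ≤ Real.sqrt K * Real.sqrt K := by gcongr
      _ = K := Real.mul_self_sqrt hK
  calc _ ≤ |cov[f, g; μ]| * (Real.sqrt (Var[f; μ]) * Real.sqrt (Var[g; μ])) := by
        gcongr; exact le_abs_self _
    _ ≤ |cov[f, g; μ]| * K := by gcongr
    _ = _ := mul_comm _ _

/-- Under (A1°) and (A2°), for independent `X ~ F j d` and `Y ~ F i d` (modelled via the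
product measure), the sequence `‖X - Y‖₁/d - E(‖X - Y‖₁/d)` converges in probability
to `0` as `d → ∞`. -/
theorem mdist_stmt8
    (J : ℕ) (hJ : 2 ≤ J)
    (F : Fin J → (d : ℕ) → Measure (Fin d → ℝ))
    [∀ j d, IsProbabilityMeasure (F j d)]
    -- coordinates have finite second moments
    (hmom : ∀ (j : Fin J) (d : ℕ) (q : Fin d), Integrable (fun x => (x q) ^ 2) (F j d))
    -- (A1°): uniformly bounded second moments
    (M : ℝ)
    (hA1 : ∀ (j : Fin J) (d : ℕ) (q : Fin d), (∫ x, (x q) ^ 2 ∂(F j d)) ≤ M)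
    -- (A2°): the sum over pairs r ≠ s of |Corr(|U_r|, |U_s|)| is o(d²)
    (hA2 : ∀ j i : Fin J, Tendsto (fun d : ℕ =>
        (∑ r : Fin d, ∑ s : Fin d, if r ≠ s then
            |pCorr ((F j d).prod (F i d))
              (fun p => |p.1 r - p.2 r|) (fun p => |p.1 s - p.2 s|)|
          else 0) / (d : ℝ) ^ 2) atTop (nhds 0))
    (j i : Fin J) :
    ∀ ε > (0 : ℝ), Tendsto (fun d : ℕ =>
        ((F j d).prod (F i d))
          {p | ε ≤ |(∑ q, |p.1 q - p.2 q|) / (d : ℝ)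
              - ∫ p', (∑ q, |p'.1 q - p'.2 q|) / (d : ℝ) ∂((F j d).prod (F i d))|})
      atTop (nhds 0) := by
  intro ε hε
  have hL : ∀ (j : Fin J) (d : ℕ) (q : Fin d), MemLp (fun x : Fin d → ℝ => x q) 2 (F j d) :=
    fun j d q => (memLp_two_iff_integrable_sq (measurable_pi_apply q).aestronglyMeasurable).2 (hmom j d q)
  have hS : ∀ (d : ℕ) (q : Fin d), MemLp (fun p : (Fin d → ℝ) × (Fin d → ℝ) => p.1 q - p.2 q) 2
      ((F j d).prod (F i d)) := fun d q =>
    ((hL j d q).comp_fst (F i d)).sub ((hL i d q).comp_snd (F j d))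
  have hZ : ∀ (d : ℕ) (q : Fin d), MemLp (fun p : (Fin d → ℝ) × (Fin d → ℝ) => |p.1 q - p.2 q|) 2
      ((F j d).prod (F i d)) := fun d q => (hS d q).abs
  have hV : ∀ (d : ℕ) (q : Fin d), Var[fun p : (Fin d → ℝ) × (Fin d → ℝ) => |p.1 q - p.2 q|;
      (F j d).prod (F i d)] ≤ 4 * M := by
    intro d q
    refine (variance_le_expectation_sq (hZ d q).aestronglyMeasurable).trans ?_
    have i1 := ((hmom j d q).comp_fst (F i d)).const_mul 2
    have i2 := ((hmom i d q).comp_snd (F j d)).const_mul 2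
    calc _ ≤ ∫ p : (Fin d → ℝ) × (Fin d → ℝ), (2 * (p.1 q) ^ 2 + 2 * (p.2 q) ^ 2)
            ∂((F j d).prod (F i d)) := by
          refine integral_mono (hZ d q).integrable_sq (i1.add i2) fun p => ?_
          simp only [Pi.pow_apply, sq_abs]
          nlinarith [sq_nonneg (p.1 q + p.2 q)]
      _ = 2 * (∫ x, (x q) ^ 2 ∂(F j d)) + 2 * (∫ x, (x q) ^ 2 ∂(F i d)) := by
          rw [integral_add i1 i2, integral_const_mul, integral_const_mul,
            integral_fun_fst (fun x : Fin d → ℝ => (x q) ^ 2),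
            integral_fun_snd (fun x : Fin d → ℝ => (x q) ^ 2)]
          simp
      _ ≤ 4 * M := by linarith [hA1 j d q, hA1 i d q]
  set C : ℕ → ℝ := fun d : ℕ =>
        (∑ r : Fin d, ∑ s : Fin d, if r ≠ s then
            |pCorr ((F j d).prod (F i d))
              (fun p => |p.1 r - p.2 r|) (fun p => |p.1 s - p.2 s|)|
          else 0) / (d : ℝ) ^ 2 with hC
  have hC0 : Tendsto C atTop (nhds 0) := hA2 j i
  have hvar : ∀ d : ℕ, 0 < d → Var[fun p : (Fin d → ℝ) × (Fin d → ℝ) =>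
      (∑ q, |p.1 q - p.2 q|) / (d : ℝ); (F j d).prod (F i d)] ≤
        4 * M * (1 / (d : ℝ)) + 4 * M * C d := by
    intro d hd
    have hd' : (0 : ℝ) < d := by exact_mod_cast hd
    simp only [div_eq_mul_inv]
    rw [variance_mul_const, variance_fun_sum (hZ d)]
    have hb : ∑ r : Fin d, ∑ s : Fin d, cov[fun p : (Fin d → ℝ) × (Fin d → ℝ) => |p.1 r - p.2 r|,
        fun p => |p.1 s - p.2 s|; (F j d).prod (F i d)] ≤
        ∑ r : Fin d, ∑ s : Fin d, ((if r = s then 4 * M else 0) + 4 * M * (if r ≠ s then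
            |pCorr ((F j d).prod (F i d))
              (fun p => |p.1 r - p.2 r|) (fun p => |p.1 s - p.2 s|)|
          else 0)) := by
      refine Finset.sum_le_sum fun r _ => Finset.sum_le_sum fun s _ => ?_
      by_cases h : r = s
      · subst h
        rw [covariance_self (hZ d r).aemeasurable]
        simpa using hV d r
      · simpa [h] using cov_le_aux _ (hZ d r) (hZ d s) (hV d r) (hV d s)
    refine (mul_le_mul_of_nonneg_right hb (by positivity)).trans (le_of_eq ?_)
    simp only [Finset.sum_add_distrib, ← Finset.mul_sum, hC]
    simp only [Finset.sum_ite_eq, Finset.mem_univ, if_true, Finset.sum_const, Finset.card_univ,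
      Fintype.card_fin, nsmul_eq_mul]
    field_simp
  have hlim : Tendsto (fun d : ℕ => ENNReal.ofReal ((4 * M * (1 / (d : ℝ)) + 4 * M * C d) / ε ^ 2))
      atTop (nhds 0) := by
    have := ((tendsto_one_div_atTop_nhds_zero_nat (𝕜 := ℝ)).const_mul (4 * M)).add
      (hC0.const_mul (4 * M))
    have := ENNReal.tendsto_ofReal (this.div_const (ε ^ 2))
    simpa using this
  refine tendsto_of_tendsto_of_tendsto_of_le_of_le' tendsto_const_nhds hlim
    (Eventually.of_forall fun _ => zero_le) ?_
  filter_upwards [eventually_gt_atTop 0] with d hd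
  have hm : MemLp (fun p : (Fin d → ℝ) × (Fin d → ℝ) => (∑ q, |p.1 q - p.2 q|) / (d : ℝ)) 2
      ((F j d).prod (F i d)) := by
    simp only [div_eq_mul_inv]
    exact (memLp_finsetSum _ fun q _ => hZ d q).mul_const _
  refine (meas_ge_le_variance_div_sq hm hε).trans (ENNReal.ofReal_le_ofReal ?_)
  gcongr
  exact hvar d hd
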